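/- arXiv:2405.11847 — 6 statements merged into one kernel-verified Lean document; each statement's English description precedes it below -/
import Mathlib

section
/- Let A be an invertible n×n real matrix with B = A⁻¹, and let u, û, f, Δf ∈ ℝⁿ and ΔA an n×n real matrix satisfy A u = f and (A + ΔA) û = f + Δf. Suppose there exist ε > 0, a nonnegative n×n matrix E, and a nonnegative vector b ∈ ℝⁿ such that |ΔA| ≤ ε E and |Δf| ≤ ε b entrywise. Then the entrywise inequality |u − û| ≤ ε |B| b + ε |B| E |u| + ε |B| E |u − û| holds, where |M| and |v| denote the entrywise absolute values of a matrix M and a vector v. -/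
open Matrix

/-- componentwise forward-error inequality
`|u − û| ≤ ε |B| b + ε |B| E |u| + ε |B| E |u − û|`. -/
theorem stmt_0 {n : ℕ} (A B ΔA E : Matrix (Fin n) (Fin n) ℝ)
    (u uhat f Δf b : Fin n → ℝ) (ε : ℝ)
    (hAB : A * B = 1) (hBA : B * A = 1)
    (hu : A.mulVec u = f)
    (huhat : (A + ΔA).mulVec uhat = f + Δf)
    (hε : 0 < ε)
    (hE : ∀ i j, 0 ≤ E i j) (hb : ∀ i, 0 ≤ b i)
    (hΔA : ∀ i j, |ΔA i j| ≤ ε * E i j)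
    (hΔf : ∀ i, |Δf i| ≤ ε * b i) :
    ∀ i, |u i - uhat i| ≤
      ε * ((B.map (fun x => |x|)).mulVec b) i
      + ε * (((B.map (fun x => |x|)) * E).mulVec (fun j => |u j|)) i
      + ε * (((B.map (fun x => |x|)) * E).mulVec (fun j => |u j - uhat j|)) i := by
  intro i
  have hdiff : uhat - u = B.mulVec (Δf - ΔA.mulVec uhat) := by
    have hres : A.mulVec (uhat - u) = Δf - ΔA.mulVec uhat := by
      rw [Matrix.add_mulVec] at huhat
      rw [Matrix.mulVec_sub, hu, sub_eq_sub_iff_add_eq_add, huhat, add_comm]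
    rw [← hres, Matrix.mulVec_mulVec, hBA, Matrix.one_mulVec]
  have hresidual (k : Fin n) : |Δf k - ΔA.mulVec uhat k| ≤
      ε * b k + ε * ∑ j, E k j * (|u j| + |u j - uhat j|) := by
    have hmul : |ΔA.mulVec uhat k| ≤ ε * ∑ j, E k j * (|u j| + |u j - uhat j|) := by
      rw [Finset.mul_sum]
      simp only [Matrix.mulVec, dotProduct]
      refine (Finset.abs_sum_le_sum_abs (fun j => ΔA k j * uhat j) Finset.univ).trans
        (Finset.sum_le_sum fun j _ => ?_)
      rw [abs_mul, ← mul_assoc]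
      have huj : |uhat j| ≤ |u j| + |u j - uhat j| := by
        simpa using abs_sub (u j) (u j - uhat j)
      exact mul_le_mul (hΔA k j) huj (abs_nonneg _) (mul_nonneg hε.le (hE k j))
    exact (abs_sub _ _).trans (add_le_add (hΔf k) hmul)
  calc
    |u i - uhat i| = |∑ k, B i k * (Δf k - ΔA.mulVec uhat k)| := by
      rw [abs_sub_comm]
      exact congrArg abs (congrFun hdiff i)
    _ ≤ ∑ k, |B i k| * (ε * b k + ε * ∑ j, E k j * (|u j| + |u j - uhat j|)) := by
      refine (Finset.abs_sum_le_sum_abs _ _).trans (Finset.sum_le_sum fun k _ => ?_)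
      rw [abs_mul]
      exact mul_le_mul_of_nonneg_left (hresidual k) (abs_nonneg _)
    _ = _ := by
      simp only [← Matrix.mulVec_mulVec]
      simp only [Matrix.mulVec, dotProduct, Matrix.map_apply, mul_add,
        Finset.sum_add_distrib, Finset.mul_sum, add_assoc, mul_left_comm ε]
end

section
/- Let A be an invertible n×n real matrix with B = A⁻¹, and let u, û, f, Δf ∈ ℝⁿ and ΔA an n×n real matrix satisfy A u = f and (A + ΔA) û = f + Δf, with |ΔA| ≤ ε E and |Δf| ≤ ε b entrywise for some ε > 0, a nonnegative n×n m-Hessenberg matrix E, and a nonnegative b ∈ ℝⁿ. Assume there is k with k + m ≤ n such that b(i) = 0 for i > k and u(i) = 0 for i > k. If ε ‖|B| E‖_∞ ≤ c for some constant c < 1, then ‖u − û‖_∞ ≤ (ε / (1 − ε ‖|B| E‖_∞)) · ‖ |B₁| b₁ + |B̃₁| E₁₁ |u₁| ‖_∞, where B₁ consists of the first k columns of B, B̃₁ consists of the first k+m columns of B, E₁₁ is the top-left (k+m)×k block of E, b₁ = (b(1),…,b(k))ᵀ, and u₁ = (u(1),…,u(k))ᵀ. -/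
open Matrix Finset

/-- The vector ∞-norm `‖v‖_∞ = max_i |v i|`. -/
noncomputable def vecInfNorm {n : ℕ} (v : Fin n → ℝ) : ℝ := ⨆ i, |v i|

/-- The matrix norm induced by the vector ∞-norm: `‖M‖_∞ = max_i Σ_j |M i j|`. -/
noncomputable def matInfNorm {n : ℕ} (M : Matrix (Fin n) (Fin n) ℝ) : ℝ :=
  ⨆ i, ∑ j, |M i j|

theorem abs_le_vecInfNorm {n : ℕ} (v : Fin n → ℝ) (i : Fin n) : |v i| ≤ vecInfNorm v :=
  le_ciSup (f := fun i => |v i|) (Set.finite_range _).bddAbove i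

theorem vecInfNorm_nonneg {n : ℕ} (v : Fin n → ℝ) : 0 ≤ vecInfNorm v :=
  Real.iSup_nonneg fun _ => abs_nonneg _

theorem sum_abs_le_matInfNorm {n : ℕ} (M : Matrix (Fin n) (Fin n) ℝ) (i : Fin n) :
    ∑ j, |M i j| ≤ matInfNorm M :=
  le_ciSup (f := fun i => ∑ j, |M i j|) (Set.finite_range _).bddAbove i

theorem matInfNorm_nonneg {n : ℕ} (M : Matrix (Fin n) (Fin n) ℝ) : 0 ≤ matInfNorm M :=
  Real.iSup_nonneg fun _ => Finset.sum_nonneg fun _ _ => abs_nonneg _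

theorem abs_mulVec_le {n : ℕ} (M : Matrix (Fin n) (Fin n) ℝ) (v : Fin n → ℝ) (i : Fin n) :
    |M.mulVec v i| ≤ ∑ j, |M i j| * |v j| := by
  simp only [Matrix.mulVec, dotProduct, ← abs_mul]
  exact Finset.abs_sum_le_sum_abs _ _

theorem sum_abs_mul_le_norm_mul_norm {n : ℕ} (M : Matrix (Fin n) (Fin n) ℝ) (v : Fin n → ℝ)
    (i : Fin n) : ∑ j, |M i j| * |v j| ≤ matInfNorm M * vecInfNorm v := by
  calc ∑ j, |M i j| * |v j| ≤ ∑ j, |M i j| * vecInfNorm v :=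
        Finset.sum_le_sum fun j _ =>
          mul_le_mul_of_nonneg_left (abs_le_vecInfNorm v j) (abs_nonneg _)
    _ = (∑ j, |M i j|) * vecInfNorm v := by rw [Finset.sum_mul]
    _ ≤ _ := mul_le_mul_of_nonneg_right (sum_abs_le_matInfNorm M i) (vecInfNorm_nonneg v)

/-- The error of a perturbed linear system in terms of the inverse and the perturbations. -/
theorem sub_eq_mulVec_of_perturbed {n : ℕ} {A B ΔA : Matrix (Fin n) (Fin n) ℝ}
    {u uhat f Δf : Fin n → ℝ} (hBA : B * A = 1) (hu : A.mulVec u = f)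
    (huhat : (A + ΔA).mulVec uhat = f + Δf) :
    u - uhat = B.mulVec (ΔA.mulVec u - ΔA.mulVec (u - uhat) - Δf) := by
  have h : A.mulVec (u - uhat) = ΔA.mulVec u - ΔA.mulVec (u - uhat) - Δf := by
    rw [Matrix.add_mulVec] at huhat
    rw [Matrix.mulVec_sub, Matrix.mulVec_sub, hu, eq_sub_of_add_eq huhat]
    abel
  rw [← h, Matrix.mulVec_mulVec, hBA, Matrix.one_mulVec]

/-- Componentwise forward-error bound for a perturbed linear system. -/
theorem abs_sub_le_of_perturbed {n : ℕ} {A B ΔA E : Matrix (Fin n) (Fin n) ℝ}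
    {u uhat f Δf b : Fin n → ℝ} {ε : ℝ} (hBA : B * A = 1) (hu : A.mulVec u = f)
    (huhat : (A + ΔA).mulVec uhat = f + Δf)
    (hΔA : ∀ i j, |ΔA i j| ≤ ε * E i j) (hΔf : ∀ i, |Δf i| ≤ ε * b i) (i : Fin n) :
    |(u - uhat) i| ≤ ε * (∑ j, |B i j| * b j + ∑ p, ∑ j, |B i p| * E p j * |u j|)
      + ε * ∑ j, (B.map (fun x => |x|) * E) i j * |(u - uhat) j| := by
  have hmv : ∀ (v : Fin n → ℝ) p, |ΔA.mulVec v p| ≤ ∑ j, ε * E p j * |v j| := fun v p =>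
    (abs_mulVec_le ΔA v p).trans <| Finset.sum_le_sum fun j _ =>
      mul_le_mul_of_nonneg_right (hΔA p j) (abs_nonneg _)
  have hres : ∀ p, |(ΔA.mulVec u - ΔA.mulVec (u - uhat) - Δf) p| ≤
      ∑ j, ε * E p j * |u j| + ∑ j, ε * E p j * |(u - uhat) j| + ε * b p := fun p =>
    (abs_sub _ _).trans <| add_le_add
      ((abs_sub _ _).trans (add_le_add (hmv u p) (hmv (u - uhat) p))) (hΔf p)
  have hcomm : ∑ j, (B.map (fun x => |x|) * E) i j * |(u - uhat) j| =
      ∑ p, |B i p| * ∑ j, E p j * |(u - uhat) j| := by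
    simp only [Matrix.mul_apply, Matrix.map_apply, Finset.sum_mul, Finset.mul_sum]
    rw [Finset.sum_comm]
    simp only [mul_assoc]
  calc |(u - uhat) i|
      = |B.mulVec (ΔA.mulVec u - ΔA.mulVec (u - uhat) - Δf) i| := by
        rw [← sub_eq_mulVec_of_perturbed hBA hu huhat]
    _ ≤ ∑ p, |B i p| * |(ΔA.mulVec u - ΔA.mulVec (u - uhat) - Δf) p| := abs_mulVec_le _ _ _
    _ ≤ ∑ p, |B i p| *
          (∑ j, ε * E p j * |u j| + ∑ j, ε * E p j * |(u - uhat) j| + ε * b p) :=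
        Finset.sum_le_sum fun p _ => mul_le_mul_of_nonneg_left (hres p) (abs_nonneg _)
    _ = _ := by
        rw [hcomm, ← mul_add, ← Finset.sum_add_distrib, ← Finset.sum_add_distrib,
          Finset.mul_sum]
        refine Finset.sum_congr rfl fun p _ => ?_
        simp only [mul_assoc, ← Finset.mul_sum]
        ring

/-- the forward-error bound
`‖u − û‖_∞ ≤ ε/(1 − ε‖|B|E‖_∞) · ‖ |B₁| b₁ + |B̃₁| E₁₁ |u₁| ‖_∞`
for an `m`-Hessenberg backward-error bound `E` and data supported on the
first `k` entries. -/
theorem stmt_3 {n : ℕ} (m k : ℕ) (A B ΔA E : Matrix (Fin n) (Fin n) ℝ)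
    (u uhat f Δf b : Fin n → ℝ) (ε c : ℝ)
    (hAB : A * B = 1) (hBA : B * A = 1)
    (hu : A.mulVec u = f)
    (huhat : (A + ΔA).mulVec uhat = f + Δf)
    (hε : 0 < ε)
    (hE : ∀ i j, 0 ≤ E i j) (hb : ∀ i, 0 ≤ b i)
    (hΔA : ∀ i j, |ΔA i j| ≤ ε * E i j)
    (hΔf : ∀ i, |Δf i| ≤ ε * b i)
    (hHess : ∀ i j : Fin n, (j : ℕ) + m < (i : ℕ) → E i j = 0)
    (hkm : k + m ≤ n)
    (hbk : ∀ i : Fin n, k ≤ (i : ℕ) → b i = 0)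
    (huk : ∀ i : Fin n, k ≤ (i : ℕ) → u i = 0)
    (hc : ε * matInfNorm ((B.map (fun x => |x|)) * E) ≤ c)
    (hc1 : c < 1) :
    vecInfNorm (u - uhat) ≤
      ε / (1 - ε * matInfNorm ((B.map (fun x => |x|)) * E)) *
        vecInfNorm (fun i : Fin n =>
          (∑ j ∈ Finset.univ.filter (fun j : Fin n => (j : ℕ) < k), |B i j| * b j)
          + ∑ p ∈ Finset.univ.filter (fun p : Fin n => (p : ℕ) < k + m),
              ∑ j ∈ Finset.univ.filter (fun j : Fin n => (j : ℕ) < k),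
                |B i p| * E p j * |u j|) := by
  have hred : ∀ i : Fin n,
      (∑ j ∈ Finset.univ.filter (fun j : Fin n => (j : ℕ) < k), |B i j| * b j)
        + ∑ p ∈ Finset.univ.filter (fun p : Fin n => (p : ℕ) < k + m),
            ∑ j ∈ Finset.univ.filter (fun j : Fin n => (j : ℕ) < k),
              |B i p| * E p j * |u j|
      = ∑ j, |B i j| * b j + ∑ p, ∑ j, |B i p| * E p j * |u j| := by
    intro i
    have hsupp : ∀ p, ∑ j ∈ Finset.univ.filter (fun j : Fin n => (j : ℕ) < k),
        |B i p| * E p j * |u j| = ∑ j, |B i p| * E p j * |u j| := fun p =>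
      Finset.sum_filter_of_ne fun j _ hj => by
        contrapose! hj
        simp [huk j hj]
    congr 1
    · refine Finset.sum_filter_of_ne fun j _ hj => ?_
      contrapose! hj
      simp [hbk j hj]
    · simp only [hsupp]
      refine Finset.sum_filter_of_ne fun p _ hp => ?_
      contrapose! hp
      refine Finset.sum_eq_zero fun j _ => ?_
      rcases lt_or_ge (j : ℕ) k with hj | hj
      · simp [hHess p j (by omega)]
      · simp [huk j hj]
  simp only [hred]
  set M := B.map (fun x => |x|) * E with hM
  set g : Fin n → ℝ := fun i => ∑ j, |B i j| * b j + ∑ p, ∑ j, |B i p| * E p j * |u j| with hg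
  have hpos : 0 < 1 - ε * matInfNorm M := by linarith
  have hbound : vecInfNorm (u - uhat) ≤
      ε * vecInfNorm g + ε * (matInfNorm M * vecInfNorm (u - uhat)) := by
    refine Real.iSup_le (fun i => ?_) (add_nonneg (mul_nonneg hε.le (vecInfNorm_nonneg _))
      (mul_nonneg hε.le (mul_nonneg (matInfNorm_nonneg _) (vecInfNorm_nonneg _))))
    refine (abs_sub_le_of_perturbed hBA hu huhat hΔA hΔf i).trans (add_le_add ?_ ?_)
    · exact mul_le_mul_of_nonneg_left ((le_abs_self _).trans (abs_le_vecInfNorm g i)) hε.le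
    · refine mul_le_mul_of_nonneg_left (le_trans ?_ (sum_abs_mul_le_norm_mul_norm M _ i)) hε.le
      exact Finset.sum_le_sum fun j _ =>
        mul_le_mul_of_nonneg_right (le_abs_self _) (abs_nonneg _)
  rw [div_mul_eq_mul_div, le_div_iff₀ hpos]
  linarith
end

section
/- Let m ≥ 0 and n > m. Let A' be an (n+1)×(n+1) real m-Hessenberg matrix and let A be its leading principal n×n submatrix. Suppose A = Q R and A' = Q' R', where Q (n×n) and Q' ((n+1)×(n+1)) are orthogonal matrices and R (n×n) and R' ((n+1)×(n+1)) are upper triangular matrices with strictly positive diagonal entries. Then the factorizations agree in their leading portions: R(i,j) = R'(i,j) for all 1 ≤ i ≤ n − m and 1 ≤ j ≤ n; Q(j,i) = Q'(j,i) for all 1 ≤ j ≤ n and 1 ≤ i ≤ n − m; and Q'(n+1, i) = 0 for all 1 ≤ i ≤ n − m. -/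
open Matrix

/-- If the first `k` entries of row `i` of `Q * R` vanish, where `R` is upper triangular with
positive diagonal, then so do the first `k` entries of row `i` of `Q`. -/
theorem eq_zero_of_mul_upperTriangular {N : ℕ} {Q R : Matrix (Fin N) (Fin N) ℝ}
    (htri : ∀ i j : Fin N, (j : ℕ) < (i : ℕ) → R i j = 0) (hdiag : ∀ i, 0 < R i i)
    (i : Fin N) (k : ℕ) (hzero : ∀ j : Fin N, (j : ℕ) < k → (Q * R) i j = 0) :
    ∀ j : Fin N, (j : ℕ) < k → Q i j = 0 := by
  intro j
  induction hd : (j : ℕ) using Nat.strong_induction_on generalizing j with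
  | _ d ih =>
    intro hj
    have hsum : (Q * R) i j = Q i j * R j j := by
      rw [mul_apply]
      refine Finset.sum_eq_single j (fun l _ hl => ?_) (by simp)
      rcases lt_or_gt_of_ne (Fin.val_ne_of_ne hl) with h | h
      · rw [ih l (hd ▸ h) l rfl (by omega), zero_mul]
      · rw [htri l j h, mul_zero]
    have h0 := hzero j (by omega)
    rw [hsum] at h0
    exact (mul_eq_zero.mp h0).resolve_right (hdiag j).ne'

/-- the QR factorizations (with positive-diagonal `R`) of an
`m`-Hessenberg matrix `A'` of size `(n+1)×(n+1)` and of its leading principal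
`n×n` submatrix `A` agree in their leading portions. -/
theorem stmt_7 (m n : ℕ) (hmn : m < n)
    (A' Q' R' : Matrix (Fin (n + 1)) (Fin (n + 1)) ℝ)
    (A Q R : Matrix (Fin n) (Fin n) ℝ)
    (hHess : ∀ i j : Fin (n + 1), (j : ℕ) + m < (i : ℕ) → A' i j = 0)
    (hA : A = A'.submatrix Fin.castSucc Fin.castSucc)
    (hQ : Qᵀ * Q = 1) (hQ' : Q'ᵀ * Q' = 1)
    (hRtri : ∀ i j : Fin n, (j : ℕ) < (i : ℕ) → R i j = 0)
    (hR'tri : ∀ i j : Fin (n + 1), (j : ℕ) < (i : ℕ) → R' i j = 0)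
    (hRdiag : ∀ i, 0 < R i i) (hR'diag : ∀ i, 0 < R' i i)
    (hQR : A = Q * R) (hQR' : A' = Q' * R') :
    (∀ i j : Fin n, (i : ℕ) < n - m → R i j = R' i.castSucc j.castSucc) ∧
    (∀ j i : Fin n, (i : ℕ) < n - m → Q j i = Q' j.castSucc i.castSucc) ∧
    (∀ i : Fin (n + 1), (i : ℕ) < n - m → Q' (Fin.last n) i = 0) := by
  have hlast : ∀ i : Fin (n + 1), (i : ℕ) < n - m → Q' (Fin.last n) i = 0 :=
    eq_zero_of_mul_upperTriangular hR'tri hR'diag _ _ fun j hj => by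
      rw [← hQR']
      exact hHess _ _ (by simp only [Fin.val_last]; omega)
  have hR : R = Qᵀ * A := by rw [hQR, ← Matrix.mul_assoc, hQ, Matrix.one_mul]
  have hR' : R' = Q'ᵀ * A' := by rw [hQR', ← Matrix.mul_assoc, hQ', Matrix.one_mul]
  have hrow : ∀ i : Fin n, (i : ℕ) < n - m → (∀ k, Q k i = Q' k.castSucc i.castSucc) →
      ∀ j, R i j = R' i.castSucc j.castSucc := by
    intro i hi hcol j
    rw [hR, hR', mul_apply, mul_apply, Fin.sum_univ_castSucc]
    simp only [transpose_apply, hlast i.castSucc hi, zero_mul, add_zero, hcol, hA,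
      submatrix_apply]
  have hcol : ∀ i : Fin n, (i : ℕ) < n - m → ∀ k, Q k i = Q' k.castSucc i.castSucc := by
    intro i
    induction hd : (i : ℕ) using Nat.strong_induction_on generalizing i with
    | _ d ih =>
      subst hd
      intro hi
      have hprop : ∀ k, Q k i * R i i =
          Q' k.castSucc i.castSucc * R' i.castSucc i.castSucc := by
        intro k
        have h : (Q * R) k i = (Q' * R') k.castSucc i.castSucc := by
          rw [← hQR, ← hQR', hA, submatrix_apply]
        rw [mul_apply, mul_apply, Fin.sum_univ_castSucc,
          hR'tri (Fin.last n) i.castSucc (by simp), mul_zero, add_zero, ← sub_eq_zero,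
          ← Finset.sum_sub_distrib, Finset.sum_eq_single i _ (by simp)] at h
        · exact sub_eq_zero.mp h
        · intro l _ hl
          rcases lt_or_gt_of_ne (Fin.val_ne_of_ne hl) with h' | h'
          · have hl' : (l : ℕ) < n - m := h'.trans hi
            have hc := ih l h' l rfl hl'
            rw [hc k, hrow l hl' hc i, sub_self]
          · rw [hRtri l i h', hR'tri l.castSucc i.castSucc h', mul_zero, mul_zero, sub_self]
      have hnorm : ∑ k, Q k i * Q k i = 1 := by
        simpa [mul_apply] using congrFun (congrFun hQ i) i
      have hnorm' : ∑ k : Fin n, Q' k.castSucc i.castSucc * Q' k.castSucc i.castSucc = 1 := by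
        simpa [mul_apply, Fin.sum_univ_castSucc, hlast i.castSucc hi] using
          congrFun (congrFun hQ' i.castSucc) i.castSucc
      have hsq : R i i ^ 2 = R' i.castSucc i.castSucc ^ 2 := by
        have hsum : (∑ k, Q k i * Q k i) * R i i ^ 2 =
            (∑ k : Fin n, Q' k.castSucc i.castSucc * Q' k.castSucc i.castSucc) *
              R' i.castSucc i.castSucc ^ 2 := by
          rw [Finset.sum_mul, Finset.sum_mul]
          refine Finset.sum_congr rfl fun k _ => ?_
          linear_combination (Q k i * R i i +
            Q' k.castSucc i.castSucc * R' i.castSucc i.castSucc) * hprop k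
        rwa [hnorm, hnorm', one_mul, one_mul] at hsum
      have hdiag : R i i = R' i.castSucc i.castSucc :=
        (pow_left_inj₀ (hRdiag i).le (hR'diag _).le two_ne_zero).mp hsq
      intro k
      have hk := hprop k
      rw [← hdiag] at hk
      exact mul_right_cancel₀ (hRdiag i).ne' hk
  exact ⟨fun i j hi => hrow i hi (hcol i hi) j, fun j i hi => hcol i hi j, hlast⟩
end

section
/- Let m ≥ 0 and n ≤ n⁺. Let R be an n×n and R⁺ an n⁺×n⁺ real upper triangular invertible matrix such that R(i,j) = R⁺(i,j) for all 1 ≤ i, j ≤ n − m. Let s ∈ ℝⁿ and s⁺ ∈ ℝ^{n⁺} satisfy s(i) = s⁺(i) for 1 ≤ i ≤ n − m, s(i) = 0 for i > n − m, and s⁺(i) = 0 for i > n − m. Then the unique solutions u of R u = s and u⁺ of R⁺ u⁺ = s⁺ satisfy u(i) = u⁺(i) for all 1 ≤ i ≤ n − m, u(i) = 0 for all i > n − m, and u⁺(i) = 0 for all i > n − m. -/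
open Matrix

/-- An invertible upper triangular matrix has nonzero diagonal entries. -/
theorem diag_ne_zero_of_upperTriangular {n : ℕ} {K : Type*} [Field K]
    {R : Matrix (Fin n) (Fin n) K} (htri : ∀ i j : Fin n, (j : ℕ) < (i : ℕ) → R i j = 0)
    (hinv : IsUnit R.det) (i : Fin n) : R i i ≠ 0 := by
  have hdet : R.det = ∏ i, R i i := Matrix.det_of_isUpperTriangular fun i j h => htri i j h
  rw [hdet, isUnit_iff_ne_zero, Finset.prod_ne_zero_iff] at hinv
  exact hinv i (Finset.mem_univ i)

/-- Back substitution: if the right-hand side of an invertible upper triangular system vanishes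
from index `k` on, then so does its solution. -/
theorem eq_zero_of_upperTriangular_mulVec {n : ℕ} {K : Type*} [Field K]
    {R : Matrix (Fin n) (Fin n) K} (htri : ∀ i j : Fin n, (j : ℕ) < (i : ℕ) → R i j = 0)
    (hinv : IsUnit R.det) {u : Fin n → K} {k : ℕ}
    (hu : ∀ i : Fin n, k ≤ (i : ℕ) → (R *ᵥ u) i = 0) (i : Fin n) (hi : k ≤ (i : ℕ)) :
    u i = 0 := by
  induction hd : n - (i : ℕ) using Nat.strong_induction_on generalizing i with
  | _ d ih =>
    have hsum : (R *ᵥ u) i = R i i * u i := by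
      simp only [Matrix.mulVec, dotProduct]
      refine Finset.sum_eq_single i (fun j _ hj => ?_) (fun h => absurd (Finset.mem_univ i) h)
      rcases lt_or_gt_of_ne (Fin.val_ne_of_ne hj) with h | h
      · rw [htri i j h, zero_mul]
      · rw [ih (n - j) (by omega) j (by omega) rfl, mul_zero]
    exact (mul_eq_zero.mp (hsum.symm.trans (hu i hi))).resolve_left
      (diag_ne_zero_of_upperTriangular htri hinv i)

/-- solutions of two nested upper triangular systems whose data
agree on the leading `n − m` entries (and vanish beyond) agree on the leading
`n − m` entries and vanish beyond. -/
theorem stmt_10 (m n nplus : ℕ) (hn : n ≤ nplus)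
    (R : Matrix (Fin n) (Fin n) ℝ) (Rplus : Matrix (Fin nplus) (Fin nplus) ℝ)
    (s u : Fin n → ℝ) (splus uplus : Fin nplus → ℝ)
    (htri : ∀ i j : Fin n, (j : ℕ) < (i : ℕ) → R i j = 0)
    (htriplus : ∀ i j : Fin nplus, (j : ℕ) < (i : ℕ) → Rplus i j = 0)
    (hinv : IsUnit R.det) (hinvplus : IsUnit Rplus.det)
    (hRagree : ∀ i j : Fin n, (i : ℕ) < n - m → (j : ℕ) < n - m →
      R i j = Rplus (Fin.castLE hn i) (Fin.castLE hn j))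
    (hsagree : ∀ i : Fin n, (i : ℕ) < n - m → s i = splus (Fin.castLE hn i))
    (hs : ∀ i : Fin n, n - m ≤ (i : ℕ) → s i = 0)
    (hsplus : ∀ i : Fin nplus, n - m ≤ (i : ℕ) → splus i = 0)
    (hu : R.mulVec u = s) (huplus : Rplus.mulVec uplus = splus) :
    (∀ i : Fin n, (i : ℕ) < n - m → u i = uplus (Fin.castLE hn i)) ∧
    (∀ i : Fin n, n - m ≤ (i : ℕ) → u i = 0) ∧
    (∀ i : Fin nplus, n - m ≤ (i : ℕ) → uplus i = 0) := by
  have hu0 : ∀ i : Fin n, n - m ≤ (i : ℕ) → u i = 0 :=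
    eq_zero_of_upperTriangular_mulVec htri hinv fun i hi => by rw [hu, hs i hi]
  have huplus0 : ∀ i : Fin nplus, n - m ≤ (i : ℕ) → uplus i = 0 :=
    eq_zero_of_upperTriangular_mulVec htriplus hinvplus fun i hi => by rw [huplus, hsplus i hi]
  refine ⟨fun i _ => ?_, hu0, huplus0⟩
  have hdiff : R *ᵥ (u - fun i => uplus (Fin.castLE hn i)) = 0 := by
    have key : R *ᵥ (fun i => uplus (Fin.castLE hn i)) = s := by
      funext i
      by_cases hi : (i : ℕ) < n - m
      · rw [hsagree i hi, ← huplus]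
        simp only [Matrix.mulVec, dotProduct]
        refine Finset.sum_of_injOn (Fin.castLE hn) (Fin.castLE_injective hn).injOn
          (fun _ _ => Finset.mem_coe.mpr (Finset.mem_univ _)) (fun j _ hj => ?_) (fun j _ => ?_)
        · have hjn : n - m ≤ (j : ℕ) := by
            by_contra! h
            exact hj ⟨⟨j, by omega⟩, by simp, rfl⟩
          rw [huplus0 j hjn, mul_zero]
        · by_cases hj : (j : ℕ) < n - m
          · rw [hRagree i j hi hj]
          · rw [huplus0 (Fin.castLE hn j) (not_lt.mp hj), mul_zero, mul_zero]
      · rw [hs i (not_lt.mp hi)]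
        simp only [Matrix.mulVec, dotProduct]
        refine Finset.sum_eq_zero fun j _ => ?_
        by_cases hj : (j : ℕ) < i
        · rw [htri i j hj, zero_mul]
        · rw [huplus0 (Fin.castLE hn j) (by simp; omega), mul_zero]
    rw [Matrix.mulVec_sub, hu, key, sub_self]
  exact sub_eq_zero.mp (eq_zero_of_upperTriangular_mulVec htri hinv (k := 0)
    (fun i _ => congrFun hdiff i) i (Nat.zero_le _))
end

section
/- Let m ≥ 0 and n ≤ n⁺, let Q be an n×n and Q⁺ an n⁺×n⁺ real orthogonal matrix, R an n×n and R⁺ an n⁺×n⁺ upper triangular invertible matrix, and suppose: (i) Q(j,i) = Q⁺(j,i) for all 1 ≤ j ≤ n and 1 ≤ i ≤ n − m; (ii) R(i,j) = R⁺(i,j) for all 1 ≤ i, j ≤ n − m; (iii) f ∈ ℝⁿ with zero-padded extension f⁺ ∈ ℝ^{n⁺} satisfies (Qᵀ f)(i) = 0 for all i > n − m and ((Q⁺)ᵀ f⁺)(i) = 0 for all i > n − m. Then the solutions u of R u = Qᵀ f and u⁺ of R⁺ u⁺ = (Q⁺)ᵀ f⁺ satisfy u(i) = u⁺(i) for all 1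 ≤ i ≤ n − m, and u(i) = 0 for i > n − m, u⁺(i) = 0 for i > n − m; in particular the zero-padded extension of u to length n⁺ equals u⁺ on the first n − m coordinates and both vanish beyond coordinate n − m. -/
open Matrix

/-- The solution of an invertible upper triangular system vanishes wherever the tail of the
right-hand side does. -/
theorem Matrix.eq_zero_of_upperTriangular_mulVec_tail {n k : ℕ} {R : Matrix (Fin n) (Fin n) ℝ}
    (htri : ∀ i j : Fin n, (j : ℕ) < (i : ℕ) → R i j = 0) (hinv : IsUnit R.det)
    {v : Fin n → ℝ} (hv : ∀ i : Fin n, k ≤ (i : ℕ) → R.mulVec v i = 0)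
    (i : Fin n) (hi : k ≤ (i : ℕ)) : v i = 0 := by
  have hdiag : ∀ i, R i i ≠ 0 := by
    rw [Matrix.det_of_isUpperTriangular fun i j hij => htri i j hij] at hinv
    exact fun i => Finset.prod_ne_zero_iff.mp hinv.ne_zero i (Finset.mem_univ i)
  induction i using WellFoundedGT.induction with
  | ind i ih =>
    have hsum : R.mulVec v i = R i i * v i := by
      simp only [Matrix.mulVec, dotProduct]
      refine Finset.sum_eq_single i (fun j _ hji => ?_) fun h => absurd (Finset.mem_univ i) h
      rcases lt_or_gt_of_ne hji with h | h
      · rw [htri i j h, zero_mul]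
      · rw [ih j h (hi.trans h.le), mul_zero]
    exact (mul_eq_zero.mp (hsum.symm.trans (hv i hi))).resolve_left (hdiag i)

/-- A sum over `Fin N` of terms vanishing from index `n` on is the sum over `Fin n`. -/
theorem Fin.sum_castLE_of_tail_eq_zero {n N : ℕ} (h : n ≤ N) (g : Fin N → ℝ)
    (hg : ∀ j : Fin N, n ≤ (j : ℕ) → g j = 0) : ∑ i : Fin n, g (Fin.castLE h i) = ∑ j, g j := by
  refine Fintype.sum_of_injective (Fin.castLE h) (Fin.castLE_injective h) _ _
    (fun j hj => hg j ?_) fun _ => rfl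
  by_contra! hlt
  exact hj ⟨⟨j, hlt⟩, rfl⟩

/-- nested QR-based solves. If `Q, Q⁺` are orthogonal and agree on
the first `n − m` columns, `R, R⁺` are upper triangular invertible and agree on
the leading `(n−m) × (n−m)` block, and the transformed right-hand sides `Qᵀ f`
and `(Q⁺)ᵀ f⁺` vanish beyond entry `n − m`, then the solutions of
`R u = Qᵀ f` and `R⁺ u⁺ = (Q⁺)ᵀ f⁺` agree on the first `n − m` entries and
vanish beyond. -/
theorem stmt_13 (m n nplus : ℕ) (hn : n ≤ nplus)
    (Q R : Matrix (Fin n) (Fin n) ℝ)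
    (Qplus Rplus : Matrix (Fin nplus) (Fin nplus) ℝ)
    (f u : Fin n → ℝ) (fplus uplus : Fin nplus → ℝ)
    (hQ : Qᵀ * Q = 1) (hQplus : Qplusᵀ * Qplus = 1)
    (htri : ∀ i j : Fin n, (j : ℕ) < (i : ℕ) → R i j = 0)
    (htriplus : ∀ i j : Fin nplus, (j : ℕ) < (i : ℕ) → Rplus i j = 0)
    (hinv : IsUnit R.det) (hinvplus : IsUnit Rplus.det)
    (hQagree : ∀ (j : Fin n) (i : Fin n), (i : ℕ) < n - m →
      Q j i = Qplus (Fin.castLE hn j) (Fin.castLE hn i))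
    (hRagree : ∀ i j : Fin n, (i : ℕ) < n - m → (j : ℕ) < n - m →
      R i j = Rplus (Fin.castLE hn i) (Fin.castLE hn j))
    (hfplus : ∀ j : Fin nplus, fplus j = if h : (j : ℕ) < n then f ⟨j, h⟩ else 0)
    (hs : ∀ i : Fin n, n - m ≤ (i : ℕ) → Qᵀ.mulVec f i = 0)
    (hsplus : ∀ i : Fin nplus, n - m ≤ (i : ℕ) → Qplusᵀ.mulVec fplus i = 0)
    (hu : R.mulVec u = Qᵀ.mulVec f)
    (huplus : Rplus.mulVec uplus = Qplusᵀ.mulVec fplus) :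
    (∀ i : Fin n, (i : ℕ) < n - m → u i = uplus (Fin.castLE hn i)) ∧
    (∀ i : Fin n, n - m ≤ (i : ℕ) → u i = 0) ∧
    (∀ i : Fin nplus, n - m ≤ (i : ℕ) → uplus i = 0) := by
  have hu0 : ∀ i : Fin n, n - m ≤ (i : ℕ) → u i = 0 :=
    Matrix.eq_zero_of_upperTriangular_mulVec_tail htri hinv fun i hi => by rw [hu, hs i hi]
  have hup0 : ∀ i : Fin nplus, n - m ≤ (i : ℕ) → uplus i = 0 :=
    Matrix.eq_zero_of_upperTriangular_mulVec_tail htriplus hinvplus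
      fun i hi => by rw [huplus, hsplus i hi]
  refine ⟨fun i _ => ?_, hu0, hup0⟩
  have hrhs : ∀ i : Fin n, (i : ℕ) < n - m →
      Qᵀ.mulVec f i = Qplusᵀ.mulVec fplus (Fin.castLE hn i) := by
    intro i hi
    simp only [Matrix.mulVec, dotProduct, Matrix.transpose_apply]
    rw [← Fin.sum_castLE_of_tail_eq_zero hn _
      fun j hj => by rw [hfplus j, dif_neg (not_lt.mpr hj), mul_zero]]
    refine Finset.sum_congr rfl fun j _ => ?_
    simp [hQagree j i hi, hfplus]
  have hlhs : ∀ i : Fin n, (i : ℕ) < n - m →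
      R.mulVec (fun j => uplus (Fin.castLE hn j)) i =
        Rplus.mulVec uplus (Fin.castLE hn i) := by
    intro i hi
    simp only [Matrix.mulVec, dotProduct]
    rw [← Fin.sum_castLE_of_tail_eq_zero hn _
      fun j hj => by rw [hup0 j ((Nat.sub_le n m).trans hj), mul_zero]]
    refine Finset.sum_congr rfl fun j _ => ?_
    rcases lt_or_ge (j : ℕ) (n - m) with hj | hj
    · rw [hRagree i j hi hj]
    · rw [hup0 (Fin.castLE hn j) hj, mul_zero, mul_zero]
  have hdiff : ∀ i : Fin n, R.mulVec (u - fun j => uplus (Fin.castLE hn j)) i = 0 := by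
    intro i
    rcases lt_or_ge (i : ℕ) (n - m) with hi | hi
    · rw [Matrix.mulVec_sub, Pi.sub_apply, hlhs i hi, hu, huplus, hrhs i hi, sub_self]
    · simp only [Matrix.mulVec, dotProduct]
      refine Finset.sum_eq_zero fun j _ => ?_
      rcases lt_or_ge (j : ℕ) (i : ℕ) with hj | hj
      · rw [htri i j hj, zero_mul]
      · rw [Pi.sub_apply, hu0 j (hi.trans hj), hup0 (Fin.castLE hn j) (hi.trans hj), sub_zero,
          mul_zero]
  exact sub_eq_zero.mp (Matrix.eq_zero_of_upperTriangular_mulVec_tail htri hinv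
    (k := 0) (fun i _ => hdiff i) i (Nat.zero_le _))
end

section
/- Let A be an invertible n×n real matrix with B = A⁻¹, let u, û, f, Δf ∈ ℝⁿ and ΔA an n×n real matrix satisfy A u = f, (A + ΔA) û = f + Δf, |ΔA| ≤ ε E and |Δf| ≤ ε b entrywise, for ε > 0, a nonnegative n×n matrix E, and a nonnegative b ∈ ℝⁿ. Suppose there is k with b(i) = 0 for all i > k. Then the entrywise inequality |u − û| ≤ ε |B₁| b₁ + ε |B| E |u| + ε |B| E |u − û| holds, where B₁ is the n×k matrix of the first k columns of B and b₁ = (b(1),…,b(k))ᵀ; that is, the term |B| b equals |B₁| b₁ and in particular depends only on the first k columns of A⁻¹. -/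
open Matrix Finset

/-- If the weights `b` vanish outside the first `k` indices, then `|B| b` only involves the first `k`
columns of `B`. -/
theorem abs_mulVec_eq_sum_filter_lt {m : Type*} {n : ℕ} (k : ℕ) (B : Matrix m (Fin n) ℝ)
    (b : Fin n → ℝ) (hbk : ∀ i : Fin n, k ≤ (i : ℕ) → b i = 0) (i : m) :
    ((B.map (fun x => |x|)).mulVec b) i =
      ∑ j ∈ Finset.univ.filter (fun j : Fin n => (j : ℕ) < k), |B i j| * b j := by
  symm
  refine Finset.sum_subset (Finset.filter_subset _ _) fun j _ hj => ?_
  rw [hbk j (by simpa using hj), mul_zero]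

/-- The error of a perturbed linear system is the inverse applied to the residual. -/
theorem sub_eq_mulVec_residual {n R : Type*} [Fintype n] [DecidableEq n] [CommRing R]
    {A B ΔA : Matrix n n R} {u uhat f Δf : n → R} (hBA : B * A = 1)
    (hu : A.mulVec u = f) (huhat : (A + ΔA).mulVec uhat = f + Δf) :
    u - uhat = B.mulVec (ΔA.mulVec uhat - Δf) := by
  have hres : A.mulVec (u - uhat) = ΔA.mulVec uhat - Δf := by
    rw [Matrix.add_mulVec] at huhat
    rw [Matrix.mulVec_sub, hu, eq_sub_of_add_eq huhat]
    abel
  rw [← hres, Matrix.mulVec_mulVec, hBA, Matrix.one_mulVec]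

/-- Triangle inequality for matrix-vector products. -/
theorem abs_mulVec_le_of_abs_le {m n : Type*} [Fintype n] (M : Matrix m n ℝ) {v w : n → ℝ}
    (h : ∀ j, |v j| ≤ w j) (i : m) :
    |M.mulVec v i| ≤ (M.map (fun x => |x|)).mulVec w i := by
  refine (Finset.abs_sum_le_sum_abs _ _).trans (Finset.sum_le_sum fun j _ => ?_)
  rw [abs_mul]
  exact mul_le_mul_of_nonneg_left (h j) (abs_nonneg _)

/-- Componentwise bound for the residual of a perturbed linear system. -/
theorem abs_residual_le {m n : Type*} [Fintype n] {ΔA E : Matrix m n ℝ} {Δf b : m → ℝ}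
    {u uhat : n → ℝ} {ε : ℝ} (hΔA : ∀ i j, |ΔA i j| ≤ ε * E i j)
    (hΔf : ∀ i, |Δf i| ≤ ε * b i) (i : m) :
    |(ΔA.mulVec uhat - Δf) i| ≤
      (ε • (b + E.mulVec (fun j => |u j|) + E.mulVec (fun j => |u j - uhat j|))) i := by
  have hmul : |ΔA.mulVec uhat i| ≤
      ε * (E.mulVec (fun j => |u j|) i + E.mulVec (fun j => |u j - uhat j|) i) := by
    simp only [Matrix.mulVec, dotProduct, ← Finset.sum_add_distrib, Finset.mul_sum]
    refine (Finset.abs_sum_le_sum_abs _ _).trans (Finset.sum_le_sum fun j _ => ?_)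
    have huhat : |uhat j| ≤ |u j| + |u j - uhat j| := by
      simpa using abs_sub (u j) (u j - uhat j)
    calc |ΔA i j * uhat j| = |ΔA i j| * |uhat j| := abs_mul _ _
      _ ≤ ε * E i j * (|u j| + |u j - uhat j|) :=
        mul_le_mul (hΔA i j) huhat (abs_nonneg _) ((abs_nonneg _).trans (hΔA i j))
      _ = ε * (E i j * |u j| + E i j * |u j - uhat j|) := by ring
  have htri := abs_sub (ΔA.mulVec uhat i) (Δf i)
  simp only [Pi.sub_apply, Pi.smul_apply, Pi.add_apply, smul_eq_mul]
  linarith [hΔf i]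

/-- refined componentwise forward-error inequality when `b`
vanishes beyond its first `k` entries: `|B| b = |B₁| b₁` and
`|u − û| ≤ ε |B₁| b₁ + ε |B| E |u| + ε |B| E |u − û|`. -/
theorem stmt_14 {n : ℕ} (k : ℕ) (A B ΔA E : Matrix (Fin n) (Fin n) ℝ)
    (u uhat f Δf b : Fin n → ℝ) (ε : ℝ)
    (hAB : A * B = 1) (hBA : B * A = 1)
    (hu : A.mulVec u = f)
    (huhat : (A + ΔA).mulVec uhat = f + Δf)
    (hε : 0 < ε)
    (hE : ∀ i j, 0 ≤ E i j) (hb : ∀ i, 0 ≤ b i)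
    (hΔA : ∀ i j, |ΔA i j| ≤ ε * E i j)
    (hΔf : ∀ i, |Δf i| ≤ ε * b i)
    (hbk : ∀ i : Fin n, k ≤ (i : ℕ) → b i = 0) :
    (∀ i, ((B.map (fun x => |x|)).mulVec b) i =
      ∑ j ∈ Finset.univ.filter (fun j : Fin n => (j : ℕ) < k), |B i j| * b j) ∧
    (∀ i, |u i - uhat i| ≤
      ε * (∑ j ∈ Finset.univ.filter (fun j : Fin n => (j : ℕ) < k), |B i j| * b j)
      + ε * (((B.map (fun x => |x|)) * E).mulVec (fun j => |u j|)) i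
      + ε * (((B.map (fun x => |x|)) * E).mulVec (fun j => |u j - uhat j|)) i) := by
  refine ⟨abs_mulVec_eq_sum_filter_lt k B b hbk, fun i => ?_⟩
  have herr : u i - uhat i = B.mulVec (ΔA.mulVec uhat - Δf) i :=
    congrFun (sub_eq_mulVec_residual hBA hu huhat) i
  have hbound := abs_mulVec_le_of_abs_le B (abs_residual_le (u := u) (uhat := uhat) hΔA hΔf) i
  rw [← herr] at hbound
  simpa only [Matrix.mulVec_smul, Matrix.mulVec_add, Matrix.mulVec_mulVec, Pi.smul_apply,
    Pi.add_apply, smul_eq_mul, mul_add, abs_mulVec_eq_sum_filter_lt k B b hbk] using hbound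
end
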